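/- Let b > 0 and D < 0 be real numbers, and let Q = {(x,y,z) ∈ ℝ³ : x²y²+y²z²+z²x² + b(x²+y²+z²)² + D = 0}. Then Q is a nonempty compact connected set homeomorphic to the 2-sphere. -/

import Mathlib

/-- Radial projection is a homeomorphism from a positive level set of a continuous positive
function, homogeneous of degree `n ≠ 0`, onto the unit sphere. -/
noncomputable def levelSetHomeomorphSphere {E : Type*} [NormedAddCommGroup E] [NormedSpace ℝ E]
    (F : E → ℝ) (n : ℕ) (hn : n ≠ 0) (hF : Continuous F)
    (hom : ∀ (t : ℝ) (p : E), 0 ≤ t → F (t • p) = t ^ n * F p)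
    (pos : ∀ p, p ≠ 0 → 0 < F p) (c : ℝ) (hc : 0 < c) :
    {p : E | F p = c} ≃ₜ Metric.sphere (0 : E) 1 :=
  have ne_zero : ∀ p : {p : E | F p = c}, ‖(p : E)‖ ≠ 0 := by
    rintro ⟨p, hp⟩ h
    have h0 := hom 0 p le_rfl
    have hp0 : p = 0 := norm_eq_zero.1 h
    have hp' : F p = c := hp
    rw [zero_smul, zero_pow hn, zero_mul, ← hp0, hp'] at h0
    exact hc.ne' h0
  have pos_sphere : ∀ s : Metric.sphere (0 : E) 1, 0 < F s := fun s ↦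
    pos s (ne_zero_of_mem_unit_sphere s)
  { toFun := fun p ↦ ⟨‖(p : E)‖⁻¹ • (p : E), by
      rw [mem_sphere_zero_iff_norm, norm_smul, norm_inv, norm_norm, inv_mul_cancel₀ (ne_zero p)]⟩
    invFun := fun s ↦ ⟨(c / F s) ^ (n : ℝ)⁻¹ • (s : E), by
      have h := pos_sphere s
      rw [Set.mem_ofPred_eq, hom _ _ (by positivity), Real.rpow_inv_natCast_pow (by positivity) hn,
        div_mul_cancel₀ _ h.ne']⟩
    left_inv := by
      rintro p
      have h := ne_zero p
      have hp : F p = c := p.2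
      have hroot : c / F (‖(p : E)‖⁻¹ • (p : E)) = ‖(p : E)‖ ^ n := by
        rw [hom _ _ (by positivity), hp]
        rw [inv_pow, div_mul_cancel_right₀ hc.ne', inv_inv]
      ext
      simp only [hroot, Real.pow_rpow_inv_natCast (norm_nonneg _) hn]
      rw [smul_smul, mul_inv_cancel₀ h, one_smul]
    right_inv := by
      rintro s
      have h := pos_sphere s
      have hr : 0 < (c / F s) ^ (n : ℝ)⁻¹ := by positivity
      have hs : ‖(s : E)‖ = 1 := norm_eq_of_mem_sphere s
      ext
      simp only [norm_smul, hs, mul_one, Real.norm_of_nonneg hr.le]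
      rw [smul_smul, inv_mul_cancel₀ hr.ne', one_smul]
    continuous_toFun := by
      refine Continuous.subtype_mk ?_ _
      exact (continuous_subtype_val.norm.inv₀ ne_zero).smul continuous_subtype_val
    continuous_invFun := by
      refine Continuous.subtype_mk ?_ _
      refine Continuous.smul ?_ continuous_subtype_val
      refine Continuous.rpow_const ?_ fun s ↦ Or.inr (by positivity)
      exact continuous_const.div (hF.comp continuous_subtype_val) fun s ↦ (pos_sphere s).ne' }

/-- for `b > 0`, `D < 0`, the quartic `Q_{(1,b,0)}(D)`, the zero set of
`v + b·u² + D`, is a nonempty compact connected set homeomorphic to the 2-sphere. -/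
theorem stmt_7 (b D : ℝ) (hb : 0 < b) (hD : D < 0)
    (Q : Set (EuclideanSpace ℝ (Fin 3)))
    (hQ : Q = {p | (p 0)^2*(p 1)^2 + (p 1)^2*(p 2)^2 + (p 2)^2*(p 0)^2
        + b * ((p 0)^2 + (p 1)^2 + (p 2)^2)^2 + D = 0}) :
    Q.Nonempty ∧ IsCompact Q ∧ IsConnected Q ∧
      Nonempty (↥Q ≃ₜ ↥(Metric.sphere (0 : EuclideanSpace ℝ (Fin 3)) 1)) := by
  let F : EuclideanSpace ℝ (Fin 3) → ℝ := fun p ↦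
    (p 0)^2*(p 1)^2 + (p 1)^2*(p 2)^2 + (p 2)^2*(p 0)^2 + b * ((p 0)^2 + (p 1)^2 + (p 2)^2)^2
  have hQF : Q = {p | F p = -D} := by
    rw [hQ]
    ext p
    exact add_eq_zero_iff_eq_neg
  have hF : Continuous F := by fun_prop
  have hom : ∀ (t : ℝ) (p : EuclideanSpace ℝ (Fin 3)), 0 ≤ t → F (t • p) = t ^ 4 * F p := by
    intro t p _
    simp only [F, PiLp.smul_apply, smul_eq_mul]
    ring
  have pos : ∀ p, p ≠ 0 → 0 < F p := by
    intro p hp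
    have hu : 0 < (p 0)^2 + (p 1)^2 + (p 2)^2 := by
      have h : 0 < ‖p‖ ^ 2 := by positivity
      simpa [EuclideanSpace.norm_sq_eq, Fin.sum_univ_three] using h
    have hv : 0 ≤ (p 0)^2*(p 1)^2 + (p 1)^2*(p 2)^2 + (p 2)^2*(p 0)^2 := by positivity
    exact add_pos_of_nonneg_of_pos hv (mul_pos hb (pow_pos hu 2))
  have e : Q ≃ₜ Metric.sphere (0 : EuclideanSpace ℝ (Fin 3)) 1 :=
    (Homeomorph.setCongr hQF).trans
      (levelSetHomeomorphSphere F 4 four_ne_zero hF hom pos (-D) (neg_pos.2 hD))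
  have hcomp : IsCompact Q := by
    have := e.symm.compactSpace
    exact isCompact_iff_compactSpace.2 this
  have hconn : IsConnected Q := by
    have hrank : 1 < Module.rank ℝ (EuclideanSpace ℝ (Fin 3)) := by
      rw [← Module.finrank_eq_rank, finrank_euclideanSpace_fin]
      norm_num
    have := isConnected_iff_connectedSpace.1
      (isConnected_sphere hrank (0 : EuclideanSpace ℝ (Fin 3)) zero_le_one)
    exact isConnected_iff_connectedSpace.2 (e.symm.surjective.connectedSpace e.symm.continuous)
  exact ⟨hconn.nonempty, hcomp, hconn, ⟨e⟩⟩
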